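/- Let B be the ring of integers of a number field, let a, b, c ∈ B, and let A = B[X,Y]/(aX² + bXY + cY² − 1). If Q is a prime ideal of A whose contraction Q ∩ B to B does not contain the ideal (2, b)B, then the localization A_Q is a regular local ring. -/

import Mathlib

open MvPolynomial NumberField

/-- A commutative local ring `R` is a regular local ring if it is Noetherian and its maximal
ideal can be generated by `dim R` elements (where `dim` is the Krull dimension). -/
def IsRegularLocal (R : Type*) [CommRing R] [IsLocalRing R] : Prop :=
  IsNoetherianRing R ∧
    ∃ s : Finset R, Ideal.span (s : Set R) = IsLocalRing.maximalIdeal R ∧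
      (s.card : WithBot ℕ∞) = ringKrullDim R

/-- The polynomial `a X² + b XY + c Y² - 1` in `B[X,Y]`. -/
noncomputable abbrev quadPoly {B : Type*} [CommRing B] (a b c : B) :
    MvPolynomial (Fin 2) B :=
  C a * X 0 ^ 2 + C b * X 0 * X 1 + C c * X 1 ^ 2 - 1

/-- The ring `A = B[X,Y]/(a X² + b XY + c Y² - 1)`. -/
noncomputable abbrev QuadAlg (B : Type*) [CommRing B] (a b c : B) :=
  MvPolynomial (Fin 2) B ⧸ Ideal.span {quadPoly a b c}

open IsLocalRing

/-- Every regular local ring in the sense of Mathlib is regular in the sense of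
`IsRegularLocal`. -/
theorem IsRegularLocalRing.isRegularLocal (R : Type*) [CommRing R]
    [h : IsRegularLocalRing R] : IsRegularLocal R := by
  obtain ⟨s, hs, hspan⟩ := Submodule.FG.exists_span_finset_card_eq_spanFinrank
    (IsNoetherian.noetherian (maximalIdeal R))
  exact ⟨inferInstance, s, hspan, by rw [hs]; exact h.spanFinrank_maximalIdeal⟩

/-- Dividing a Noetherian local ring by an element of `𝔪 \ 𝔪²` lowers the minimal number of
generators of the maximal ideal. -/
theorem spanFinrank_maximalIdeal_succ_le_of_surjective {R S : Type*} [CommRing R] [CommRing S]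
    [IsLocalRing R] [IsNoetherianRing R] [IsLocalRing S] (φ : R →+* S)
    (hφ : Function.Surjective φ) {f : R} (hf : f ∈ maximalIdeal R)
    (hf2 : f ∉ maximalIdeal R ^ 2) (h0 : φ f = 0) :
    (maximalIdeal S).spanFinrank + 1 ≤ (maximalIdeal R).spanFinrank := by
  classical
  obtain ⟨s, hs, hspan⟩ := Submodule.FG.exists_span_finset_card_eq_spanFinrank
    (IsNoetherian.noetherian (maximalIdeal R))
  have hsm (x : R) (hx : x ∈ s) : x ∈ maximalIdeal R := hspan ▸ Submodule.subset_span hx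
  have hfs : f ∈ Submodule.span R (s : Set R) := hspan ▸ hf
  obtain ⟨r, -, hr⟩ := Submodule.mem_span_finset.mp hfs
  obtain ⟨x, hx, hunit⟩ : ∃ x ∈ s, IsUnit (r x) := by
    by_contra! h
    refine hf2 (hr ▸ Ideal.sum_mem _ fun x hx ↦ ?_)
    rw [sq]
    exact Ideal.mul_mem_mul ((mem_maximalIdeal _).mpr (h x hx)) (hsm x hx)
  have hle : maximalIdeal S ≤ Ideal.span (((s.erase x).image φ : Finset S) : Set S) := by
    have : IsLocalHom φ := hφ.isLocalHom
    have hcomap : (maximalIdeal R).map φ = maximalIdeal S := by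
      rw [← maximalIdeal_comap φ, Ideal.map_comap_of_surjective φ hφ]
    rw [← hcomap, ← hspan, Ideal.submodule_span_eq, Ideal.map_span, Ideal.span_le]
    have herase (y : R) (hy : y ∈ s.erase x) :
        φ y ∈ Ideal.span (((s.erase x).image φ : Finset S) : Set S) :=
      Ideal.subset_span (Finset.mem_coe.mpr (Finset.mem_image_of_mem φ hy))
    rintro _ ⟨y, hy, rfl⟩
    by_cases hyx : y = x
    · subst hyx
      rw [← Finset.add_sum_erase s _ hx] at hr
      have hφr := congrArg φ hr
      rw [map_add, h0, smul_eq_mul, map_mul, map_sum] at hφr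
      rw [SetLike.mem_coe, ← Ideal.unit_mul_mem_iff_mem _ (hunit.map φ),
        eq_neg_of_add_eq_zero_left hφr, neg_mem_iff]
      refine Ideal.sum_mem _ fun z hz ↦ ?_
      rw [smul_eq_mul, map_mul]
      exact Ideal.mul_mem_left _ _ (herase z hz)
    · exact herase y (Finset.mem_erase.mpr ⟨hyx, hy⟩)
  have heq : Ideal.span (((s.erase x).image φ : Finset S) : Set S) = maximalIdeal S := by
    refine le_antisymm (Ideal.span_le.mpr ?_) hle
    have : IsLocalHom φ := hφ.isLocalHom
    intro z hz
    obtain ⟨y, hy, rfl⟩ := Finset.mem_image.mp (Finset.mem_coe.mp hz)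
    exact map_nonunit φ y (hsm y (Finset.mem_of_mem_erase hy))
  have hcard : (maximalIdeal S).spanFinrank ≤ (s.erase x).card := by
    rw [← heq]
    refine (Submodule.spanFinrank_span_le_ncard_of_finite (Finset.finite_toSet _)).trans ?_
    rw [Set.ncard_coe_finset]
    exact Finset.card_image_le
  have := Finset.card_erase_add_one hx
  omega

/-- The quotient of a regular local ring by an element of `𝔪 \ 𝔪²` is regular. -/
theorem IsRegularLocalRing.of_surjective_of_ker_eq_span {R S : Type*} [CommRing R] [CommRing S]
    [IsRegularLocalRing R] [IsLocalRing S] (φ : R →+* S) (hφ : Function.Surjective φ) {f : R}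
    (hf : f ∈ maximalIdeal R) (hf2 : f ∉ maximalIdeal R ^ 2)
    (hker : RingHom.ker φ = Ideal.span {f}) : IsRegularLocalRing S := by
  have : IsNoetherianRing S := isNoetherianRing_of_surjective R S φ hφ
  apply IsRegularLocalRing.of_spanFinrank_maximalIdeal_le
  have h0 : φ f = 0 := by
    rw [← RingHom.mem_ker, hker]
    exact Ideal.mem_span_singleton_self f
  have hrank := spanFinrank_maximalIdeal_succ_le_of_surjective φ hφ hf hf2 h0
  have hdim := ringKrullDim_le_ringKrullDim_quotient_add_card {f}
    (by simpa [IsLocalRing.ringJacobson_eq_maximalIdeal] using hf)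
  rw [Finset.coe_singleton, ringKrullDim_eq_of_ringEquiv
    ((Ideal.quotEquivOfEq hker.symm).trans (RingHom.quotientKerEquivOfSurjective hφ)),
    ← IsRegularLocalRing.spanFinrank_maximalIdeal, Finset.card_singleton, Nat.cast_one] at hdim
  refine ENat.WithBot.add_le_add_one_right_iff.mp (le_trans ?_ hdim)
  exact_mod_cast hrank

/-- A derivation maps the square of an ideal into the ideal. -/
theorem Derivation.apply_mem_of_mem_sq {R A : Type*} [CommRing R] [CommRing A] [Algebra R A]
    (D : Derivation R A A) {I : Ideal A} {x : A} (hx : x ∈ I ^ 2) : D x ∈ I := by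
  rw [sq] at hx
  induction hx using Submodule.mul_induction_on' with
  | mem_mul_mem m hm n hn =>
    rw [D.leibniz]
    exact I.add_mem (I.mul_mem_right _ hm) (I.mul_mem_right _ hn)
  | add x _ y _ hx hy => rw [map_add]; exact I.add_mem hx hy

/-- If some derivation does not map `f ∈ P` into the prime ideal `P`, then `f` lies outside the
square of the maximal ideal of the localization at `P`. -/
theorem Derivation.algebraMap_notMem_maximalIdeal_sq {R A : Type*} [CommRing R] [CommRing A]
    [Algebra R A] (D : Derivation R A A) (P : Ideal A) [P.IsPrime] {f : A} (hf : f ∈ P)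
    (hD : D f ∉ P) :
    algebraMap A (Localization.AtPrime P) f ∉ maximalIdeal (Localization.AtPrime P) ^ 2 := by
  rw [← Localization.AtPrime.map_eq_maximalIdeal, ← Ideal.map_pow,
    IsLocalization.algebraMap_mem_map_algebraMap_iff P.primeCompl]
  rintro ⟨s, hs, hsf⟩
  have h := D.apply_mem_of_mem_sq hsf
  rw [D.leibniz, smul_eq_mul, smul_eq_mul, Ideal.add_mem_iff_left _ (P.mul_mem_right _ hf)] at h
  exact (‹P.IsPrime›.mem_or_mem h).elim hs hD

/-- Jacobian criterion for hypersurfaces in a regular ring. -/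
theorem IsRegularLocalRing.atPrime_quotient_span_singleton {R A : Type*} [CommRing R] [CommRing A]
    [Algebra R A] [IsRegularRing A] (D : Derivation R A A) {f : A}
    (Q : Ideal (A ⧸ Ideal.span {f})) [Q.IsPrime]
    (hD : D f ∉ Q.comap (Ideal.Quotient.mk (Ideal.span {f}))) :
    IsRegularLocalRing (Localization.AtPrime Q) := by
  set π := Ideal.Quotient.mk (Ideal.span {f})
  have hπ : Function.Surjective π := Ideal.Quotient.mk_surjective
  have hf : f ∈ Q.comap π := by
    have : π f = 0 := Ideal.Quotient.eq_zero_iff_mem.mpr (Ideal.mem_span_singleton_self f)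
    simp [Ideal.mem_comap, this]
  have hmap : (Q.comap π).primeCompl.map π = Q.primeCompl :=
    Submonoid.map_comap_eq_of_surjective hπ Q.primeCompl
  refine IsRegularLocalRing.of_surjective_of_ker_eq_span
    (Localization.localRingHom (Q.comap π) Q π rfl) ?_
    (f := algebraMap A _ f) ?_ (D.algebraMap_notMem_maximalIdeal_sq _ hf hD) ?_
  · exact RingHom.surjective_localRingHom_of_surjective π hπ Q
  · rw [← Localization.AtPrime.map_eq_maximalIdeal]
    exact Ideal.mem_map_of_mem _ hf
  · refine (IsLocalization.ker_map _ π hmap).trans ?_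
    rw [Ideal.mk_ker, Ideal.map_span, Set.image_singleton]

theorem pderiv_zero_quadPoly {B : Type*} [CommRing B] (a b c : B) :
    pderiv 0 (quadPoly a b c) = 2 * C a * X 0 + C b * X 1 := by
  simp [quadPoly]
  ring

theorem pderiv_one_quadPoly {B : Type*} [CommRing B] (a b c : B) :
    pderiv 1 (quadPoly a b c) = C b * X 0 + 2 * C c * X 1 := by
  simp [quadPoly]
  ring

/-- If a prime contains `a X² + b XY + c Y² - 1` and its partial derivatives, then it contains
`2` and `b`. -/
theorem two_mem_and_C_mem_of_pderiv_quadPoly_mem {B : Type*} [CommRing B] {a b c : B}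
    {P : Ideal (MvPolynomial (Fin 2) B)} (hf : quadPoly a b c ∈ P)
    (h0 : pderiv 0 (quadPoly a b c) ∈ P) (h1 : pderiv 1 (quadPoly a b c) ∈ P) :
    2 ∈ P ∧ C b ∈ P := by
  rw [pderiv_zero_quadPoly] at h0
  rw [pderiv_one_quadPoly] at h1
  have h2 : (2 : MvPolynomial (Fin 2) B) ∈ P := by
    convert P.sub_mem (P.add_mem (P.mul_mem_left (X 0) h0) (P.mul_mem_left (X 1) h1))
      (P.mul_mem_left 2 hf) using 1
    ring
  have hbY : C b * X 1 ∈ P := by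
    convert P.sub_mem h0 (P.mul_mem_left (C a * X 0) h2) using 1
    ring
  have hbX : C b * X 0 ∈ P := by
    convert P.sub_mem h1 (P.mul_mem_left (C c * X 1) h2) using 1
    ring
  refine ⟨h2, ?_⟩
  convert P.sub_mem (P.add_mem (P.mul_mem_left (C a * X 0 + C b * X 1) hbX)
    (P.mul_mem_left (C c * X 1) hbY)) (P.mul_mem_left (C b) hf) using 1
  ring

theorem regular_of_not_contains (K : Type) [Field K] [NumberField K] (a b c : 𝓞 K)
    (Q : Ideal (QuadAlg (𝓞 K) a b c)) [Q.IsPrime]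
    (hQ : ¬ Ideal.span {(2 : 𝓞 K), b} ≤
        Q.comap (algebraMap (𝓞 K) (QuadAlg (𝓞 K) a b c))) :
    IsRegularLocal (Localization.AtPrime Q) := by
  set π := Ideal.Quotient.mk (Ideal.span {quadPoly a b c})
  obtain ⟨i, hi⟩ : ∃ i : Fin 2, pderiv i (quadPoly a b c) ∉ Q.comap π := by
    by_contra! h
    have hf : quadPoly a b c ∈ Q.comap π := by
      have : π (quadPoly a b c) = 0 :=
        Ideal.Quotient.eq_zero_iff_mem.mpr (Ideal.mem_span_singleton_self _)
      simp [Ideal.mem_comap, this]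
    obtain ⟨h2, hb⟩ := two_mem_and_C_mem_of_pderiv_quadPoly_mem hf (h 0) (h 1)
    refine hQ (Ideal.span_le.mpr ?_)
    rintro x (rfl | rfl)
    · simpa only [SetLike.mem_coe, Ideal.mem_comap, map_ofNat] using h2
    · exact hb
  have := IsRegularLocalRing.atPrime_quotient_span_singleton (pderiv i) Q hi
  exact IsRegularLocalRing.isRegularLocal _
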